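/- arXiv:1803.09030 — 9 statements merged into one kernel-verified Lean document; each statement's English description precedes it below -/
import Mathlib

section
/- Let Λ be an n×n Hermitian matrix over ℂ. Then the supremum of Re(tr(E·Λ)) over all n×n matrices E satisfying 0 ≤ E ≤ I (i.e., E is positive semidefinite and I − E is positive semidefinite) equals the sum of the positive eigenvalues of Λ, i.e., Σᵢ max(λᵢ, 0) where λ₁,…,λₙ are the eigenvalues of Λ; moreover this supremum is attained when E is the orthogonal projection onto the span of the eigenvectors of Λ with positive eigenvalues. -/
open Matrix ComplexOrder

namespace Matrix.IsHermitian

variable {n : Type*} [Fintype n] [DecidableEq n] {A : Matrix n n ℂ}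

/-- The trace of a product with a Hermitian matrix, computed in an eigenbasis of the latter. -/
lemma re_trace_mul_eq_sum_eigenvalues (hA : A.IsHermitian) (E : Matrix n n ℂ) :
    (E * A).trace.re = ∑ i, ((star (hA.eigenvectorUnitary : Matrix n n ℂ) * E *
      (hA.eigenvectorUnitary : Matrix n n ℂ)) i i).re * hA.eigenvalues i := by
  conv_lhs => rw [hA.spectral_theorem, Unitary.conjStarAlgAut_apply]
  rw [← Matrix.mul_assoc, ← Matrix.mul_assoc, trace_mul_comm, ← Matrix.mul_assoc,
    ← Matrix.mul_assoc]
  simp [trace, mul_diagonal, -eigenvectorUnitary_apply]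

/-- A matrix `E` with `0 ≤ E ≤ 1` satisfies `Re (tr (E * A)) ≤ ∑ i, max (λ i) 0`. -/
lemma re_trace_mul_le_sum_max_eigenvalues (hA : A.IsHermitian) {E : Matrix n n ℂ}
    (hE : E.PosSemidef) (hE' : (1 - E).PosSemidef) :
    (E * A).trace.re ≤ ∑ i, max (hA.eigenvalues i) 0 := by
  rw [hA.re_trace_mul_eq_sum_eigenvalues]
  refine Finset.sum_le_sum fun i _ => ?_
  have h0 := (Complex.le_def.1 ((hE.conjTranspose_mul_mul_same
    (hA.eigenvectorUnitary : Matrix n n ℂ)).diag_nonneg (i := i))).1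
  have h1 := (Complex.le_def.1 ((hE'.conjTranspose_mul_mul_same
    (hA.eigenvectorUnitary : Matrix n n ℂ)).diag_nonneg (i := i))).1
  rw [Matrix.mul_sub, Matrix.sub_mul, Matrix.mul_one, ← star_eq_conjTranspose,
    Unitary.coe_star_mul_self, sub_apply, one_apply_eq, Complex.sub_re, Complex.one_re,
    Complex.zero_re] at h1
  rw [← star_eq_conjTranspose, Complex.zero_re] at h0
  calc _ ≤ _ * max (hA.eigenvalues i) 0 := mul_le_mul_of_nonneg_left (le_max_left _ _) h0
    _ ≤ _ := mul_le_of_le_one_left (le_max_right _ _) (sub_nonneg.1 h1)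

/-- The spectral projection of `A` onto its positive eigenvalues is positive semidefinite. -/
lemma posSemidef_positive_projection (hA : A.IsHermitian) :
    ((hA.eigenvectorUnitary : Matrix n n ℂ) *
      diagonal (fun i => if 0 < hA.eigenvalues i then (1 : ℂ) else 0) *
      star (hA.eigenvectorUnitary : Matrix n n ℂ)).PosSemidef := by
  refine PosSemidef.mul_mul_conjTranspose_same (PosSemidef.diagonal fun i => ?_) _
  dsimp only [Pi.zero_apply]
  split_ifs <;> simp

/-- The complement of the spectral projection of `A` onto its positive eigenvalues is positive
semidefinite. -/
lemma posSemidef_one_sub_positive_projection (hA : A.IsHermitian) :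
    (1 - (hA.eigenvectorUnitary : Matrix n n ℂ) *
      diagonal (fun i => if 0 < hA.eigenvalues i then (1 : ℂ) else 0) *
      star (hA.eigenvectorUnitary : Matrix n n ℂ)).PosSemidef := by
  have h : (1 - diagonal (fun i => if 0 < hA.eigenvalues i then (1 : ℂ) else 0)).PosSemidef := by
    rw [← diagonal_one, diagonal_sub]
    refine PosSemidef.diagonal fun i => ?_
    dsimp only [Pi.zero_apply]
    split_ifs <;> simp
  have := h.mul_mul_conjTranspose_same (hA.eigenvectorUnitary : Matrix n n ℂ)
  rwa [Matrix.mul_sub, Matrix.sub_mul, Matrix.mul_one, ← star_eq_conjTranspose,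
    Unitary.mul_star_self_of_mem hA.eigenvectorUnitary.2] at this

/-- The spectral projection of `A` onto its positive eigenvalues picks out their sum. -/
lemma re_trace_positive_projection_mul (hA : A.IsHermitian) :
    (((hA.eigenvectorUnitary : Matrix n n ℂ) *
      diagonal (fun i => if 0 < hA.eigenvalues i then (1 : ℂ) else 0) *
      star (hA.eigenvectorUnitary : Matrix n n ℂ)) * A).trace.re =
      ∑ i, max (hA.eigenvalues i) 0 := by
  rw [hA.re_trace_mul_eq_sum_eigenvalues]
  refine Finset.sum_congr rfl fun i _ => ?_
  rw [← Matrix.mul_assoc, ← Matrix.mul_assoc, Unitary.coe_star_mul_self, Matrix.one_mul,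
    Matrix.mul_assoc, Unitary.coe_star_mul_self, Matrix.mul_one, diagonal_apply_eq]
  split_ifs with h
  · simp [h.le]
  · simp [not_lt.1 h]

end Matrix.IsHermitian

/-- For an `n × n` Hermitian matrix `Λ` over `ℂ`, the supremum of `Re (tr (E * Λ))` over
all matrices `E` with `0 ≤ E ≤ I` equals the sum of the positive eigenvalues of `Λ`,
and it is attained at the orthogonal projection onto the span of the eigenvectors of `Λ`
with positive eigenvalues. -/
theorem sup_trace_povm_eq_sum_pos_eigenvalues
    {n : ℕ} (Λ : Matrix (Fin n) (Fin n) ℂ) (hΛ : Λ.IsHermitian) :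
    IsGreatest
      {x : ℝ | ∃ E : Matrix (Fin n) (Fin n) ℂ,
        E.PosSemidef ∧ (1 - E).PosSemidef ∧ x = ((E * Λ).trace).re}
      (∑ i, max (hΛ.eigenvalues i) 0) ∧
    ((((hΛ.eigenvectorUnitary : Matrix (Fin n) (Fin n) ℂ) *
        Matrix.diagonal (fun i => if 0 < hΛ.eigenvalues i then (1 : ℂ) else 0) *
        star (hΛ.eigenvectorUnitary : Matrix (Fin n) (Fin n) ℂ)).PosSemidef) ∧
     ((1 - (hΛ.eigenvectorUnitary : Matrix (Fin n) (Fin n) ℂ) *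
        Matrix.diagonal (fun i => if 0 < hΛ.eigenvalues i then (1 : ℂ) else 0) *
        star (hΛ.eigenvectorUnitary : Matrix (Fin n) (Fin n) ℂ)).PosSemidef) ∧
     ((((hΛ.eigenvectorUnitary : Matrix (Fin n) (Fin n) ℂ) *
        Matrix.diagonal (fun i => if 0 < hΛ.eigenvalues i then (1 : ℂ) else 0) *
        star (hΛ.eigenvectorUnitary : Matrix (Fin n) (Fin n) ℂ)) * Λ).trace.re =
          ∑ i, max (hΛ.eigenvalues i) 0)) := by
  refine ⟨⟨⟨_, hΛ.posSemidef_positive_projection, hΛ.posSemidef_one_sub_positive_projection,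
    hΛ.re_trace_positive_projection_mul.symm⟩, ?_⟩, hΛ.posSemidef_positive_projection,
    hΛ.posSemidef_one_sub_positive_projection, hΛ.re_trace_positive_projection_mul⟩
  rintro _ ⟨E, hE, hE', rfl⟩
  exact hΛ.re_trace_mul_le_sum_max_eigenvalues hE hE'
end

section
/- Let ρ₁, ρ₂ be density matrices on ℂ^d, and let η₁, η₂ ≥ 0 with η₁ + η₂ = 1. Set Δ = η₁ρ₁ − η₂ρ₂ (a Hermitian matrix), and let p = Σ_{λᵢ>0} λᵢ and q = −Σ_{λᵢ<0} λᵢ, where λᵢ are the eigenvalues of Δ. Then the supremum over all d²×d² matrices E with 0 ≤ E ≤ I of Re[ η₁²·tr(E (ρ₁⊗ρ₁)) + η₂²·tr(E (ρ₂⊗ρ₂)) + η₁η₂·tr((I − E)(ρ₁⊗ρ₂)) + η₁η₂·tr((I − E)(ρ₂⊗ρ₁)) ] equals 2η₁η₂ + p² + q², and it is attained by the discrimination-strategy operator E = P₊⊗P₊ + P₋⊗P₋, where P₊ (resp. P₋) is the orthogonal projection onto the span of the eigenvectors of Δ with positive (resp. negative) eigenvalues. -/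
open Matrix Kronecker ComplexOrder

lemma sum_max_mul_zero {n : Type*} [Fintype n] (f : n → ℝ) :
    ∑ k : n × n, max (f k.1 * f k.2) 0 = (∑ i, max (f i) 0) ^ 2 + (∑ i, max (-f i) 0) ^ 2 := by
  rw [sq, sq, Finset.sum_mul_sum, Finset.sum_mul_sum, ← Finset.sum_add_distrib,
    Fintype.sum_prod_type]
  refine Finset.sum_congr rfl fun i _ => ?_
  rw [← Finset.sum_add_distrib]
  refine Finset.sum_congr rfl fun j _ => ?_
  rcases le_total 0 (f i) with hi | hi <;> rcases le_total 0 (f j) with hj | hj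
  · simp [hi, hj, mul_nonneg]
  · simp [hi, hj, mul_nonpos_of_nonneg_of_nonpos]
  · simp [hi, hj, mul_nonpos_of_nonpos_of_nonneg]
  · simp [hi, hj, mul_nonneg_of_nonpos_of_nonpos]

section Diagonalized

variable {n : Type*} [Fintype n] [DecidableEq n]

lemma trace_mul_conj_diagonal (E V : Matrix n n ℂ) (f : n → ℂ) :
    (E * (V * diagonal f * star V)).trace = ∑ k, (star V * E * V) k k * f k := by
  rw [← Matrix.mul_assoc, Matrix.trace_mul_comm, ← Matrix.mul_assoc, ← Matrix.mul_assoc]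
  simp [Matrix.trace, Matrix.mul_diagonal]

lemma posSemidef_conj_diagonal (V : Matrix n n ℂ) {f : n → ℂ} (hf : ∀ k, 0 ≤ f k) :
    (V * diagonal f * star V).PosSemidef :=
  (PosSemidef.diagonal hf).mul_mul_conjTranspose_same V

/-- An effect `0 ≤ E ≤ 1` captures at most the positive part of a diagonalized observable. -/
lemma re_trace_effect_mul_conj_diagonal_le {E V : Matrix n n ℂ} (hV : star V * V = 1)
    (hE : E.PosSemidef) (hE' : (1 - E).PosSemidef) (f : n → ℝ) :
    (E * (V * diagonal (fun k => (f k : ℂ)) * star V)).trace.re ≤ ∑ k, max (f k) 0 := by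
  rw [trace_mul_conj_diagonal, Complex.re_sum]
  refine Finset.sum_le_sum fun k _ => ?_
  have h0 := (hE.conjTranspose_mul_mul_same V).diag_nonneg (i := k)
  have h1 := (hE'.conjTranspose_mul_mul_same V).diag_nonneg (i := k)
  rw [Matrix.mul_sub, Matrix.sub_mul, Matrix.mul_one, ← star_eq_conjTranspose, hV,
    Matrix.sub_apply, Matrix.one_apply_eq] at h1
  rw [← star_eq_conjTranspose] at h0
  have h0' := (Complex.le_def.1 h0).1
  have h1' := (Complex.le_def.1 h1).1
  simp only [Complex.zero_re, Complex.sub_re, Complex.one_re] at h0' h1'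
  rw [Complex.re_mul_ofReal]
  calc _ ≤ ((star V * E * V) k k).re * max (f k) 0 := by gcongr; exact le_max_left _ _
    _ ≤ 1 * max (f k) 0 := by gcongr; linarith
    _ = _ := one_mul _

lemma trace_conj_diagonal_mul_conj_diagonal {V : Matrix n n ℂ} (hV : star V * V = 1)
    (e f : n → ℂ) :
    ((V * diagonal e * star V) * (V * diagonal f * star V)).trace = ∑ k, e k * f k := by
  rw [trace_mul_conj_diagonal]
  have h : star V * (V * diagonal e * star V) * V = diagonal e := by
    calc _ = (star V * V) * diagonal e * (star V * V) := by simp only [Matrix.mul_assoc]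
      _ = _ := by simp [hV]
  simp [h]

lemma conj_diagonal_kronecker_conj_diagonal (U : Matrix n n ℂ) (a b : n → ℂ) :
    (U * diagonal a * star U) ⊗ₖ (U * diagonal b * star U) =
      (U ⊗ₖ U) * diagonal (fun k : n × n => a k.1 * b k.2) * star (U ⊗ₖ U) := by
  rw [mul_kronecker_mul, mul_kronecker_mul, diagonal_kronecker_diagonal, star_eq_conjTranspose,
    star_eq_conjTranspose, conjTranspose_kronecker]

/-- The success probability of comparison is affine in the effect, with slope `Δ ⊗ Δ`. -/
lemma comparison_success_eq (ρ₁ ρ₂ : Matrix n n ℂ) (a b : ℂ)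
    (htr₁ : ρ₁.trace = 1) (htr₂ : ρ₂.trace = 1) (E : Matrix (n × n) (n × n) ℂ) :
    a ^ 2 * (E * (ρ₁ ⊗ₖ ρ₁)).trace + b ^ 2 * (E * (ρ₂ ⊗ₖ ρ₂)).trace
      + a * b * ((1 - E) * (ρ₁ ⊗ₖ ρ₂)).trace + a * b * ((1 - E) * (ρ₂ ⊗ₖ ρ₁)).trace
      = 2 * a * b + (E * ((a • ρ₁ - b • ρ₂) ⊗ₖ (a • ρ₁ - b • ρ₂))).trace := by
  have h : (a • ρ₁ - b • ρ₂) ⊗ₖ (a • ρ₁ - b • ρ₂) = a ^ 2 • (ρ₁ ⊗ₖ ρ₁) + b ^ 2 • (ρ₂ ⊗ₖ ρ₂)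
      - (a * b) • (ρ₁ ⊗ₖ ρ₂) - (a * b) • (ρ₂ ⊗ₖ ρ₁) := by
    ext i j
    simp only [kroneckerMap_apply, Matrix.sub_apply, Matrix.add_apply, Matrix.smul_apply,
      smul_eq_mul]
    ring
  rw [h]
  simp only [Matrix.sub_mul, Matrix.one_mul, Matrix.mul_sub, Matrix.mul_add, Matrix.mul_smul,
    trace_sub, trace_add, trace_smul, smul_eq_mul, trace_kronecker, htr₁, htr₂]
  ring

end Diagonalized

/-- Minimum-error comparison of two mixed states with arbitrary priors: the optimal
success probability is `2η₁η₂ + p² + q²`, where `p` (resp. `q`) is the sum of the positive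
eigenvalues (resp. minus the sum of the negative eigenvalues) of `Δ = η₁ρ₁ - η₂ρ₂`, and it
is attained by the discrimination strategy `E = Pp ⊗ Pp + Pm ⊗ Pm` built from the Helstrom
measurement. -/
theorem mixed_state_comparison_discrimination_strategy_optimal
    {d : ℕ} (ρ₁ ρ₂ : Matrix (Fin d) (Fin d) ℂ) (η₁ η₂ : ℝ)
    (hρ₁ : ρ₁.PosSemidef) (hρ₂ : ρ₂.PosSemidef)
    (htr₁ : ρ₁.trace = 1) (htr₂ : ρ₂.trace = 1)
    (hη₁ : 0 ≤ η₁) (hη₂ : 0 ≤ η₂) (hη : η₁ + η₂ = 1)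
    (hΔ : ((η₁ : ℂ) • ρ₁ - (η₂ : ℂ) • ρ₂).IsHermitian)
    (p q : ℝ)
    (hp : p = ∑ i, max (hΔ.eigenvalues i) 0)
    (hq : q = ∑ i, max (-(hΔ.eigenvalues i)) 0)
    (Pp Pm : Matrix (Fin d) (Fin d) ℂ)
    (hPp : Pp = (hΔ.eigenvectorUnitary : Matrix (Fin d) (Fin d) ℂ) *
        Matrix.diagonal (fun i => if 0 < hΔ.eigenvalues i then (1 : ℂ) else 0) *
        star (hΔ.eigenvectorUnitary : Matrix (Fin d) (Fin d) ℂ))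
    (hPm : Pm = (hΔ.eigenvectorUnitary : Matrix (Fin d) (Fin d) ℂ) *
        Matrix.diagonal (fun i => if hΔ.eigenvalues i < 0 then (1 : ℂ) else 0) *
        star (hΔ.eigenvectorUnitary : Matrix (Fin d) (Fin d) ℂ)) :
    IsGreatest
      {x : ℝ | ∃ E : Matrix (Fin d × Fin d) (Fin d × Fin d) ℂ,
        E.PosSemidef ∧ (1 - E).PosSemidef ∧
        x = ((η₁ : ℂ)^2 * (E * (ρ₁ ⊗ₖ ρ₁)).trace + (η₂ : ℂ)^2 * (E * (ρ₂ ⊗ₖ ρ₂)).trace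
          + (η₁ : ℂ) * (η₂ : ℂ) * ((1 - E) * (ρ₁ ⊗ₖ ρ₂)).trace
          + (η₁ : ℂ) * (η₂ : ℂ) * ((1 - E) * (ρ₂ ⊗ₖ ρ₁)).trace).re}
      (2 * η₁ * η₂ + p^2 + q^2) ∧
    ((Pp ⊗ₖ Pp + Pm ⊗ₖ Pm).PosSemidef ∧ (1 - (Pp ⊗ₖ Pp + Pm ⊗ₖ Pm)).PosSemidef ∧
      ((η₁ : ℂ)^2 * ((Pp ⊗ₖ Pp + Pm ⊗ₖ Pm) * (ρ₁ ⊗ₖ ρ₁)).trace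
        + (η₂ : ℂ)^2 * ((Pp ⊗ₖ Pp + Pm ⊗ₖ Pm) * (ρ₂ ⊗ₖ ρ₂)).trace
        + (η₁ : ℂ) * (η₂ : ℂ) * ((1 - (Pp ⊗ₖ Pp + Pm ⊗ₖ Pm)) * (ρ₁ ⊗ₖ ρ₂)).trace
        + (η₁ : ℂ) * (η₂ : ℂ) * ((1 - (Pp ⊗ₖ Pp + Pm ⊗ₖ Pm)) * (ρ₂ ⊗ₖ ρ₁)).trace).re
        = 2 * η₁ * η₂ + p^2 + q^2) := by
  set U : Matrix (Fin d) (Fin d) ℂ := (hΔ.eigenvectorUnitary : Matrix (Fin d) (Fin d) ℂ)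
  set l := hΔ.eigenvalues
  have hUU : star U * U = 1 := Unitary.coe_star_mul_self hΔ.eigenvectorUnitary
  have hVV : star (U ⊗ₖ U) * (U ⊗ₖ U) = 1 := by
    rw [star_eq_conjTranspose, conjTranspose_kronecker, ← mul_kronecker_mul,
      ← star_eq_conjTranspose, hUU, one_kronecker_one]
  have hVV' : (U ⊗ₖ U) * star (U ⊗ₖ U) = 1 := mul_eq_one_comm.1 hVV
  have hspec : (η₁ : ℂ) • ρ₁ - (η₂ : ℂ) • ρ₂ = U * diagonal (fun i => (l i : ℂ)) * star U := by
    have h := hΔ.spectral_theorem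
    rw [Unitary.conjStarAlgAut_apply] at h
    exact h
  have hval : ∀ E : Matrix (Fin d × Fin d) (Fin d × Fin d) ℂ,
      ((η₁ : ℂ)^2 * (E * (ρ₁ ⊗ₖ ρ₁)).trace + (η₂ : ℂ)^2 * (E * (ρ₂ ⊗ₖ ρ₂)).trace
        + (η₁ : ℂ) * (η₂ : ℂ) * ((1 - E) * (ρ₁ ⊗ₖ ρ₂)).trace
        + (η₁ : ℂ) * (η₂ : ℂ) * ((1 - E) * (ρ₂ ⊗ₖ ρ₁)).trace).re
      = 2 * η₁ * η₂ + (E * ((U ⊗ₖ U) * diagonal (fun k : Fin d × Fin d =>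
          ((l k.1 * l k.2 : ℝ) : ℂ)) * star (U ⊗ₖ U))).trace.re := by
    intro E
    rw [comparison_success_eq ρ₁ ρ₂ _ _ htr₁ htr₂, hspec,
      conj_diagonal_kronecker_conj_diagonal, Complex.add_re]
    congr 1
    · norm_cast
    · simp only [Complex.ofReal_mul]
  have hsum : ∑ k : Fin d × Fin d, max (l k.1 * l k.2) 0 = p ^ 2 + q ^ 2 := by
    rw [hp, hq, sum_max_mul_zero]
  let e : Fin d × Fin d → ℝ := fun k => if 0 < l k.1 * l k.2 then 1 else 0
  have hE : Pp ⊗ₖ Pp + Pm ⊗ₖ Pm =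
      (U ⊗ₖ U) * diagonal (fun k => (e k : ℂ)) * star (U ⊗ₖ U) := by
    rw [hPp, hPm, conj_diagonal_kronecker_conj_diagonal, conj_diagonal_kronecker_conj_diagonal,
      ← Matrix.add_mul, ← Matrix.mul_add, diagonal_add]
    congr 3
    funext k
    rcases lt_trichotomy (l k.1) 0 with hi | hi | hi <;>
      rcases lt_trichotomy (l k.2) 0 with hj | hj | hj <;>
      simp [e, hi, hj, hi.not_gt, hj.not_gt, mul_pos_iff]
  have hE1 : 1 - (Pp ⊗ₖ Pp + Pm ⊗ₖ Pm) =
      (U ⊗ₖ U) * diagonal (fun k => ((1 - e k : ℝ) : ℂ)) * star (U ⊗ₖ U) := by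
    have h : diagonal (fun k => ((1 - e k : ℝ) : ℂ)) = 1 - diagonal (fun k => (e k : ℂ)) := by
      rw [← diagonal_one, diagonal_sub]
      simp
    rw [hE, h, Matrix.mul_sub, Matrix.sub_mul, Matrix.mul_one, hVV']
  have he0 : ∀ k, 0 ≤ e k := fun k => by simp only [e]; split_ifs <;> norm_num
  have he1 : ∀ k, 0 ≤ 1 - e k := fun k => by simp only [e]; split_ifs <;> norm_num
  have hpos : (Pp ⊗ₖ Pp + Pm ⊗ₖ Pm).PosSemidef := by
    rw [hE]
    exact posSemidef_conj_diagonal _ fun k => Complex.zero_le_real.2 (he0 k)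
  have hpos1 : (1 - (Pp ⊗ₖ Pp + Pm ⊗ₖ Pm)).PosSemidef := by
    rw [hE1]
    exact posSemidef_conj_diagonal _ fun k => Complex.zero_le_real.2 (he1 k)
  have hattain := hval (Pp ⊗ₖ Pp + Pm ⊗ₖ Pm)
  have htrace : ((Pp ⊗ₖ Pp + Pm ⊗ₖ Pm) * ((U ⊗ₖ U) * diagonal (fun k : Fin d × Fin d =>
      ((l k.1 * l k.2 : ℝ) : ℂ)) * star (U ⊗ₖ U))).trace.re = p ^ 2 + q ^ 2 := by
    rw [hE, trace_conj_diagonal_mul_conj_diagonal hVV, ← hsum, Complex.re_sum]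
    refine Finset.sum_congr rfl fun k _ => ?_
    rw [← Complex.ofReal_mul, Complex.ofReal_re]
    by_cases h : 0 < l k.1 * l k.2
    · simp only [e, if_pos h, one_mul, max_eq_left h.le]
    · simp only [e, if_neg h, zero_mul, max_eq_right (not_lt.1 h)]
  rw [htrace, ← add_assoc] at hattain
  refine ⟨⟨⟨_, hpos, hpos1, hattain.symm⟩, ?_⟩, hpos, hpos1, hattain⟩
  rintro x ⟨E, h0, h1, rfl⟩
  rw [hval, add_assoc, ← hsum]
  gcongr
  exact re_trace_effect_mul_conj_diagonal_le hVV h0 h1 _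
end

section
/- For an integer N ≥ 3, let φ_k = (|0⟩ + e^{2πik/N}|1⟩)/√2 ∈ ℂ² for k = 0, …, N−1, and define the 4×4 matrix Λ = (1/N²)·Σ_{k=0}^{N−1} |φ_k⟩⟨φ_k| ⊗ |φ_k⟩⟨φ_k| − (1/N²)·Σ_{k≠j} |φ_k⟩⟨φ_k| ⊗ |φ_j⟩⟨φ_j|. Then Λ = (1/(4N))·(σ_x⊗σ_x + σ_y⊗σ_y) + (1/(2N) − 1/4)·I₄. -/
open Matrix Kronecker

noncomputable def pauliX : Matrix (Fin 2) (Fin 2) ℂ := !![0, 1; 1, 0]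
noncomputable def pauliY : Matrix (Fin 2) (Fin 2) ℂ := !![0, -Complex.I; Complex.I, 0]

/-- The states of the `ℤ_N` phase ensemble: `φ_k = (|0⟩ + e^{2πik/N}|1⟩)/√2`. -/
noncomputable def phaseState (N : ℕ) (k : Fin N) : Fin 2 → ℂ :=
  ![1 / Real.sqrt 2, Complex.exp (2 * Real.pi * Complex.I * k / N) / Real.sqrt 2]

/-- The sum over distinct pairs of indices is the full double sum minus the diagonal. -/
lemma sum_kronecker_ne {ι m n R : Type*} [Fintype ι] [DecidableEq ι] [CommRing R]
    (A : ι → Matrix m m R) (B : ι → Matrix n n R) :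
    ∑ k, ∑ j, (if k = j then 0 else A k ⊗ₖ B j)
      = (∑ k, A k) ⊗ₖ (∑ j, B j) - ∑ k, A k ⊗ₖ B k := by
  have h : ∀ k, ∑ j, (if k = j then 0 else A k ⊗ₖ B j)
      = ∑ j, A k ⊗ₖ B j - A k ⊗ₖ B k := by
    intro k
    rw [eq_sub_iff_add_eq, ← Finset.sum_erase_add _ _ (Finset.mem_univ k), if_pos rfl, add_zero,
      ← Finset.sum_erase_add (a := k) _ (fun j => A k ⊗ₖ B j) (Finset.mem_univ k)]
    congr 1
    exact Finset.sum_congr rfl fun j hj => if_neg (Finset.ne_of_mem_erase hj).symm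
  simp_rw [h, Finset.sum_sub_distrib]
  congr 1
  ext ⟨a, b⟩ ⟨c, d⟩
  simp [Matrix.sum_apply, Finset.sum_mul_sum]

/-- The relative phase `e^{2πik/N}` of the state `φ_k`. -/
noncomputable def phase (N : ℕ) (k : Fin N) : ℂ :=
  Complex.exp (2 * Real.pi * Complex.I / N) ^ (k : ℕ)

lemma star_phase_mul_phase (N : ℕ) (k : Fin N) : star (phase N k) * phase N k = 1 := by
  have h : ‖phase N k‖ = 1 := by
    rw [phase, norm_pow, show 2 * (Real.pi : ℂ) * Complex.I / N
      = ((2 * Real.pi / N : ℝ) : ℂ) * Complex.I by push_cast; ring,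
      Complex.norm_exp_ofReal_mul_I, one_pow]
  rw [Complex.star_def, ← Complex.normSq_eq_conj_mul_self, Complex.normSq_eq_norm_sq, h]
  simp

lemma sum_phase_pow_eq_zero {N m : ℕ} (hm : 0 < m) (hN : m < N) :
    ∑ k : Fin N, phase N k ^ m = 0 := by
  have hw := Complex.isPrimitiveRoot_exp N (by omega)
  have hne := hw.pow_ne_one_of_pos_of_lt hm.ne' hN
  simp_rw [phase, pow_right_comm _ _ m]
  rw [Fin.sum_univ_eq_sum_range (fun k => (Complex.exp (2 * Real.pi * Complex.I / N) ^ m) ^ k),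
    geom_sum_eq hne, pow_right_comm, hw.pow_eq_one]
  simp

lemma vecMulVec_phaseState (N : ℕ) (k : Fin N) :
    Matrix.vecMulVec (phaseState N k) (star (phaseState N k))
      = (1 / 2 : ℂ) • !![1, star (phase N k); phase N k, 1] := by
  have hp : Complex.exp (2 * Real.pi * Complex.I * k / N) = phase N k := by
    rw [phase, ← Complex.exp_nat_mul]
    congr 1
    ring
  have hs : ((Real.sqrt 2 : ℝ) : ℂ) * (Real.sqrt 2 : ℝ) = 2 := by
    rw [← Complex.ofReal_mul, Real.mul_self_sqrt (by norm_num)]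
    norm_num
  have h1 := star_phase_mul_phase N k
  have hs' : ((Real.sqrt 2 : ℝ) : ℂ)⁻¹ * ((Real.sqrt 2 : ℝ) : ℂ)⁻¹ = 1 / 2 := by
    rw [← mul_inv, hs, one_div]
  rw [Complex.star_def] at h1
  rw [phaseState, hp]
  ext a b
  fin_cases a <;> fin_cases b <;>
    simp [Matrix.vecMulVec_apply, div_eq_mul_inv]
  · linear_combination hs'
  · linear_combination (starRingEnd ℂ (phase N k)) * hs'
  · linear_combination phase N k * hs'
  · linear_combination hs' + ((Real.sqrt 2 : ℝ) : ℂ)⁻¹ * ((Real.sqrt 2 : ℝ) : ℂ)⁻¹ * h1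

lemma sum_vecMulVec_phaseState {N : ℕ} (hN : 2 ≤ N) :
    ∑ k : Fin N, Matrix.vecMulVec (phaseState N k) (star (phaseState N k))
      = ((N : ℂ) / 2) • (1 : Matrix (Fin 2) (Fin 2) ℂ) := by
  have h1 : ∑ k : Fin N, phase N k = 0 := by
    simpa using sum_phase_pow_eq_zero one_pos (show 1 < N by omega)
  have h1' : ∑ k : Fin N, starRingEnd ℂ (phase N k) = 0 := by rw [← map_sum, h1, map_zero]
  simp_rw [vecMulVec_phaseState]
  ext a b
  fin_cases a <;> fin_cases b <;>
    simp [Matrix.sum_apply, ← Finset.mul_sum, h1, h1', div_eq_mul_inv]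

lemma sum_vecMulVec_phaseState_kronecker_self {N : ℕ} (hN : 3 ≤ N) :
    ∑ k : Fin N, (Matrix.vecMulVec (phaseState N k) (star (phaseState N k))) ⊗ₖ
        (Matrix.vecMulVec (phaseState N k) (star (phaseState N k)))
      = ((N : ℂ) / 8) • (pauliX ⊗ₖ pauliX + pauliY ⊗ₖ pauliY)
        + ((N : ℂ) / 4) • (1 : Matrix (Fin 2 × Fin 2) (Fin 2 × Fin 2) ℂ) := by
  have h1 : ∑ k : Fin N, phase N k = 0 := by
    simpa using sum_phase_pow_eq_zero one_pos (show 1 < N by omega)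
  have h1' : ∑ k : Fin N, starRingEnd ℂ (phase N k) = 0 := by rw [← map_sum, h1, map_zero]
  have h2 : ∑ k : Fin N, phase N k * phase N k = 0 := by
    simpa [sq] using sum_phase_pow_eq_zero two_pos (show 2 < N by omega)
  have h2' : ∑ k : Fin N, starRingEnd ℂ (phase N k) * starRingEnd ℂ (phase N k) = 0 := by
    simp_rw [← map_mul]
    rw [← map_sum, h2, map_zero]
  have h3 : ∀ k : Fin N, starRingEnd ℂ (phase N k) * phase N k = 1 := star_phase_mul_phase N
  have h3' : ∀ k : Fin N, phase N k * starRingEnd ℂ (phase N k) = 1 := fun k => by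
    rw [mul_comm, h3]
  simp_rw [vecMulVec_phaseState, Matrix.smul_kronecker, Matrix.kronecker_smul, ← Finset.smul_sum]
  ext ⟨a, b⟩ ⟨c, d⟩
  fin_cases a <;> fin_cases b <;> fin_cases c <;> fin_cases d <;>
    simp [Matrix.sum_apply, h1, h1', h2, h2', h3, h3', pauliX, pauliY] <;>
    ring

/-- For `N ≥ 3` the comparison operator `Λ` of the `N` phase states equals
`(1/(4N))(σ_x⊗σ_x + σ_y⊗σ_y) + (1/(2N) - 1/4) I₄`. -/
theorem comparison_operator_phase_states (N : ℕ) (hN : 3 ≤ N) :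
    ((1 / (N : ℂ)^2) • ∑ k : Fin N,
        (Matrix.vecMulVec (phaseState N k) (star (phaseState N k))) ⊗ₖ
          (Matrix.vecMulVec (phaseState N k) (star (phaseState N k)))
      - (1 / (N : ℂ)^2) • ∑ k : Fin N, ∑ j : Fin N, (if k = j then 0 else
        (Matrix.vecMulVec (phaseState N k) (star (phaseState N k))) ⊗ₖ
          (Matrix.vecMulVec (phaseState N j) (star (phaseState N j)))))
    = (1 / (4 * (N : ℂ))) • (pauliX ⊗ₖ pauliX + pauliY ⊗ₖ pauliY)
      + (1 / (2 * (N : ℂ)) - 1 / 4) • (1 : Matrix (Fin 2 × Fin 2) (Fin 2 × Fin 2) ℂ) := by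
  have hN0 : (N : ℂ) ≠ 0 := Nat.cast_ne_zero.mpr (by omega)
  rw [sum_kronecker_ne (fun k => Matrix.vecMulVec (phaseState N k) (star (phaseState N k)))
      (fun j => Matrix.vecMulVec (phaseState N j) (star (phaseState N j))),
    sum_vecMulVec_phaseState (by omega), sum_vecMulVec_phaseState_kronecker_self hN,
    Matrix.smul_kronecker, Matrix.kronecker_smul, Matrix.one_kronecker_one]
  match_scalars <;> field_simp <;> ring
end

section
/- Let φ_k = (|0⟩ + e^{2πik/3}|1⟩)/√2 ∈ ℂ² for k = 0, 1, 2, and Λ = (1/9)·Σ_{k=0}^{2} |φ_k⟩⟨φ_k| ⊗ |φ_k⟩⟨φ_k| − (1/9)·Σ_{k≠j} |φ_k⟩⟨φ_k| ⊗ |φ_j⟩⟨φ_j|. Then the supremum over 4×4 matrices E with 0 ≤ E ≤ I of Re[ 2/3 + tr(E·Λ) ] equals 3/4, and it is attained at E = |Φ₊⟩⟨Φ₊| where Φ₊ = (|01⟩ + |10⟩)/√2. -/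
open Matrix Kronecker ComplexOrder

/-- The comparison operator `Λ` of the `N` equiprobable phase states. -/
noncomputable def comparisonOp (N : ℕ) : Matrix (Fin 2 × Fin 2) (Fin 2 × Fin 2) ℂ :=
  (1 / (N : ℂ)^2) • ∑ k : Fin N,
      (Matrix.vecMulVec (phaseState N k) (star (phaseState N k))) ⊗ₖ
        (Matrix.vecMulVec (phaseState N k) (star (phaseState N k)))
    - (1 / (N : ℂ)^2) • ∑ k : Fin N, ∑ j : Fin N, (if k = j then 0 else
      (Matrix.vecMulVec (phaseState N k) (star (phaseState N k))) ⊗ₖ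
        (Matrix.vecMulVec (phaseState N j) (star (phaseState N j))))

/-- Tensor (Kronecker) product of two vectors in `ℂ²`. -/
def tens (a b : Fin 2 → ℂ) : Fin 2 × Fin 2 → ℂ := fun p => a p.1 * b p.2

noncomputable def bellPhiPlus : Fin 2 × Fin 2 → ℂ :=
  (1 / (Real.sqrt 2 : ℂ)) • (tens ![1, 0] ![0, 1] + tens ![0, 1] ![1, 0])

theorem phaseState_three_apply (k : Fin 3) (i : Fin 2) :
    phaseState 3 k i = Complex.exp (2 * Real.pi * Complex.I / 3) ^ (k.val * i.val) / Real.sqrt 2 := by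
  fin_cases i
  · simp [phaseState]
  · simp [phaseState, ← Complex.exp_nat_mul]
    ring_nf

theorem star_phaseState_three_apply (k : Fin 3) (i : Fin 2) :
    star (phaseState 3 k i) =
      Complex.exp (2 * Real.pi * Complex.I / 3) ^ (2 * (k.val * i.val)) / Real.sqrt 2 := by
  have hω : IsPrimitiveRoot (Complex.exp (2 * Real.pi * Complex.I / 3)) 3 := by
    exact_mod_cast Complex.isPrimitiveRoot_exp 3 (by norm_num)
  have hconj : star (Complex.exp (2 * Real.pi * Complex.I / 3)) =
      Complex.exp (2 * Real.pi * Complex.I / 3) ^ 2 := by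
    have h3 := hω.pow_eq_one
    have hinv := Complex.inv_eq_conj (hω.norm'_eq_one (by norm_num))
    rw [Complex.star_def, ← hinv]
    exact inv_eq_of_mul_eq_one_right (by rw [← h3]; ring)
  rw [phaseState_three_apply, star_div₀, star_pow, hconj, ← pow_mul]
  simp

/-- The comparison operator of the three phase states is block diagonal in the excitation
number `p.1 + p.2`. -/
theorem comparisonOp_three_apply (p q : Fin 2 × Fin 2) :
    comparisonOp 3 p q =
      (if p.1.val + p.2.val = q.1.val + q.2.val then 1 / 6 else 0) - if p = q then 1 / 4 else 0 := by
  have hω : IsPrimitiveRoot (Complex.exp (2 * Real.pi * Complex.I / 3)) 3 := by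
    exact_mod_cast Complex.isPrimitiveRoot_exp 3 (by norm_num)
  have hsum := hω.geom_sum_eq_zero (by norm_num)
  have h2 : ((Real.sqrt 2 : ℂ))⁻¹ ^ 2 = 1 / 2 := by
    rw [inv_pow, ← Complex.ofReal_pow, Real.sq_sqrt (by norm_num)]
    norm_num
  simp only [comparisonOp, Fin.sum_univ_three, Fin.reduceEq, if_true, if_false, zero_add, add_zero,
    Matrix.sub_apply, Matrix.smul_apply, Matrix.add_apply, Matrix.kroneckerMap_apply,
    Matrix.vecMulVec_apply, Pi.star_apply, star_phaseState_three_apply]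
  simp only [phaseState_three_apply, div_eq_mul_inv _ (Real.sqrt 2 : ℂ)]
  generalize Complex.exp (2 * Real.pi * Complex.I / 3) = ω at *
  generalize ((Real.sqrt 2 : ℂ))⁻¹ = s at *
  simp only [Finset.sum_range_succ, Finset.sum_range_zero] at hsum
  obtain ⟨a, b⟩ := p
  obtain ⟨c, d⟩ := q
  fin_cases a <;> fin_cases b <;> fin_cases c <;> fin_cases d <;>
    simp <;> grind

theorem re_trace_mul_comparisonOp_three (E : Matrix (Fin 2 × Fin 2) (Fin 2 × Fin 2) ℂ) :
    (E * comparisonOp 3).trace.re =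
      -(1 / 12) * ((E (0, 0) (0, 0)).re + (E (0, 1) (0, 1)).re + (E (1, 0) (1, 0)).re
        + (E (1, 1) (1, 1)).re) + (1 / 6) * ((E (0, 1) (1, 0)).re + (E (1, 0) (0, 1)).re) := by
  simp [Matrix.trace, Matrix.mul_apply, Fintype.sum_prod_type, comparisonOp_three_apply]
  ring

theorem re_trace_mul_comparisonOp_three_le {E : Matrix (Fin 2 × Fin 2) (Fin 2 × Fin 2) ℂ}
    (hE : E.PosSemidef) (hE' : (1 - E).PosSemidef) :
    (E * comparisonOp 3).trace.re ≤ 1 / 12 := by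
  have h00 := (Complex.le_def.1 (hE.diag_nonneg (i := (0, 0)))).1
  have h11 := (Complex.le_def.1 (hE.diag_nonneg (i := (1, 1)))).1
  have hminus := (Complex.le_def.1
    (hE.dotProduct_mulVec_nonneg (tens ![1, 0] ![0, 1] - tens ![0, 1] ![1, 0]))).1
  have hplus := (Complex.le_def.1
    (hE'.dotProduct_mulVec_nonneg (tens ![1, 0] ![0, 1] + tens ![0, 1] ![1, 0]))).1
  simp [dotProduct, Matrix.mulVec, Fintype.sum_prod_type, tens, Matrix.one_apply]
    at h00 h11 hminus hplus
  rw [re_trace_mul_comparisonOp_three]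
  linarith

theorem dotProduct_star_bellPhiPlus : star bellPhiPlus ⬝ᵥ bellPhiPlus = 1 := by
  have h2 : ((Real.sqrt 2 : ℂ))⁻¹ * (Real.sqrt 2 : ℂ)⁻¹ = 1 / 2 := by
    rw [← mul_inv, ← Complex.ofReal_mul, Real.mul_self_sqrt (by norm_num)]
    norm_num
  simp [dotProduct, Fintype.sum_prod_type, bellPhiPlus, tens, h2]
  norm_num

theorem posSemidef_one_sub_vecMulVec_star {n : Type*} [Fintype n] [DecidableEq n] {v : n → ℂ}
    (hv : star v ⬝ᵥ v = 1) : (1 - Matrix.vecMulVec v (star v)).PosSemidef := by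
  have hH : (1 - Matrix.vecMulVec v (star v))ᴴ = 1 - Matrix.vecMulVec v (star v) := by
    simp [Matrix.conjTranspose_vecMulVec]
  have hsq : (1 - Matrix.vecMulVec v (star v))ᴴ * (1 - Matrix.vecMulVec v (star v)) =
      1 - Matrix.vecMulVec v (star v) := by
    rw [hH]
    simp [sub_mul, mul_sub, Matrix.vecMulVec_mul_vecMulVec, hv]
  rw [← hsq]
  exact Matrix.posSemidef_conjTranspose_mul_self _

theorem re_trace_bellPhiPlus_mul_comparisonOp_three :
    (Matrix.vecMulVec bellPhiPlus (star bellPhiPlus) * comparisonOp 3).trace.re = 1 / 12 := by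
  have h2 : (Real.sqrt 2)⁻¹ * (Real.sqrt 2)⁻¹ = 1 / 2 := by
    rw [← mul_inv, Real.mul_self_sqrt (by norm_num)]
    norm_num
  rw [re_trace_mul_comparisonOp_three]
  simp [Matrix.vecMulVec_apply, bellPhiPlus, tens, ← Complex.ofReal_inv, h2]
  norm_num

/-- For the three phase states (`N = 3`), the optimal comparison success probability
`sup Re(2/3 + tr(EΛ))` over POVM elements `0 ≤ E ≤ I` equals `3/4`, attained at
`E = |Φ₊⟩⟨Φ₊|`. -/
theorem three_state_comparison_optimal :
    IsGreatest
      {x : ℝ | ∃ E : Matrix (Fin 2 × Fin 2) (Fin 2 × Fin 2) ℂ,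
        E.PosSemidef ∧ (1 - E).PosSemidef ∧
        x = ((2 / 3 : ℂ) + (E * comparisonOp 3).trace).re}
      (3 / 4) ∧
    ((Matrix.vecMulVec bellPhiPlus (star bellPhiPlus)).PosSemidef ∧
     (1 - Matrix.vecMulVec bellPhiPlus (star bellPhiPlus)).PosSemidef ∧
     ((2 / 3 : ℂ) + (Matrix.vecMulVec bellPhiPlus (star bellPhiPlus) *
        comparisonOp 3).trace).re = 3 / 4) := by
  have hpos : (Matrix.vecMulVec bellPhiPlus (star bellPhiPlus)).PosSemidef :=
    Matrix.posSemidef_vecMulVec_self_star _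
  have hsub := posSemidef_one_sub_vecMulVec_star dotProduct_star_bellPhiPlus
  have hval : ((2 / 3 : ℂ) + (Matrix.vecMulVec bellPhiPlus (star bellPhiPlus) *
      comparisonOp 3).trace).re = 3 / 4 := by
    rw [Complex.add_re, re_trace_bellPhiPlus_mul_comparisonOp_three]
    norm_num
  refine ⟨⟨⟨_, hpos, hsub, hval.symm⟩, ?_⟩, hpos, hsub, hval⟩
  rintro x ⟨E, hE, hE', rfl⟩
  have hle := re_trace_mul_comparisonOp_three_le hE hE'
  rw [Complex.add_re]
  norm_num
  linarith
end

section
/- Let φ_k = (|0⟩ + e^{2πik/3}|1⟩)/√2 ∈ ℂ² for k = 0, 1, 2, and Λ = (1/9)·Σ_{k=0}^{2} |φ_k⟩⟨φ_k| ⊗ |φ_k⟩⟨φ_k| − (1/9)·Σ_{k≠j} |φ_k⟩⟨φ_k| ⊗ |φ_j⟩⟨φ_j|. With e_k = (2/3)·|φ_k⟩⟨φ_k| and E_disc = Σ_{k=0}^{2} e_k ⊗ e_k, one has tr(E_disc · Λ) = 0; hence the discrimination strategy yields comparison success probability 2/3 + tr(E_disc·Λ) = 2/3, which is strictly less than the optimal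 value 3/4. -/
open Matrix Kronecker

/-- The optimal discrimination POVM element `e_k = (2/3)|φ_k⟩⟨φ_k|` for the three
phase states. -/
noncomputable def discPOVM (k : Fin 3) : Matrix (Fin 2) (Fin 2) ℂ :=
  (2 / 3 : ℂ) • Matrix.vecMulVec (phaseState 3 k) (star (phaseState 3 k))

theorem trace_phaseState_proj_mul (N : ℕ) (k j : Fin N) :
    (vecMulVec (phaseState N k) (star (phaseState N k)) *
      vecMulVec (phaseState N j) (star (phaseState N j))).trace =
      (((1 + Real.cos (2 * Real.pi * ((k : ℝ) - j) / N)) / 2 : ℝ) : ℂ) := by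
  have hs : ((Real.sqrt 2 : ℝ) : ℂ) ^ 2 = 2 := by
    rw [← Complex.ofReal_pow, Real.sq_sqrt (by norm_num)]
    norm_num
  have hs0 : ((Real.sqrt 2 : ℝ) : ℂ) ≠ 0 := by
    intro h
    simp [h] at hs
  have hconj (m : Fin N) : (starRingEnd ℂ) (Complex.exp (2 * Real.pi * Complex.I * m / N)) =
      Complex.exp (-(2 * Real.pi * Complex.I * m / N)) := by
    rw [← Complex.exp_conj]
    congr 1
    simp [Complex.conj_ofNat]
    ring
  have hcos : (2 : ℂ) * Complex.cos (2 * Real.pi * ((k : ℂ) - j) / N) =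
      Complex.exp (2 * Real.pi * Complex.I * k / N) *
          Complex.exp (-(2 * Real.pi * Complex.I * j / N)) +
        Complex.exp (2 * Real.pi * Complex.I * j / N) *
          Complex.exp (-(2 * Real.pi * Complex.I * k / N)) := by
    rw [Complex.two_cos, ← Complex.exp_add, ← Complex.exp_add]
    congr 2 <;> ring
  have hinv (m : Fin N) : Complex.exp (2 * Real.pi * Complex.I * m / N) *
      Complex.exp (-(2 * Real.pi * Complex.I * m / N)) = 1 := by
    rw [← Complex.exp_add, add_neg_cancel, Complex.exp_zero]
  have hk := hinv k
  have hj := hinv j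
  rw [vecMulVec_mul_vecMulVec, trace_vecMulVec]
  simp only [dotProduct, Pi.smul_apply, Fin.sum_univ_two, phaseState, Pi.star_apply, cons_val_zero,
    cons_val_one, RCLike.star_def, map_div₀, map_one, Complex.conj_ofReal, hconj, smul_eq_mul]
  push_cast
  generalize Complex.exp (2 * Real.pi * Complex.I * k / N) = a at *
  generalize Complex.exp (-(2 * Real.pi * Complex.I * k / N)) = a' at *
  generalize Complex.exp (2 * Real.pi * Complex.I * j / N) = b at *
  generalize Complex.exp (-(2 * Real.pi * Complex.I * j / N)) = b' at *
  generalize ((Real.sqrt 2 : ℝ) : ℂ) = s at *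
  have h4 : s ^ 4 = 4 := by linear_combination (s ^ 2 + 2) * hs
  field_simp
  rw [h4]
  linear_combination 2 * b * b' * hk + 2 * hj - 2 * hcos

theorem trace_phaseState_three_proj_mul (k j : Fin 3) :
    (vecMulVec (phaseState 3 k) (star (phaseState 3 k)) *
      vecMulVec (phaseState 3 j) (star (phaseState 3 j))).trace =
      if k = j then 1 else 1 / 4 := by
  have h1 : Real.cos (2 * Real.pi / 3) = -1 / 2 := by
    rw [show 2 * Real.pi / 3 = Real.pi - Real.pi / 3 by ring, Real.cos_pi_sub,
      Real.cos_pi_div_three]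
    norm_num
  have h2 : Real.cos (2 * Real.pi * 2 / 3) = -1 / 2 := by
    rw [show 2 * Real.pi * 2 / 3 = Real.pi / 3 + Real.pi by ring, Real.cos_add_pi,
      Real.cos_pi_div_three]
    norm_num
  rw [trace_phaseState_proj_mul]
  fin_cases k <;> fin_cases j <;> norm_num [neg_div, h1, h2, -Complex.ofReal_cos]

/-- For the three phase states, the discrimination strategy
`E_disc = Σ_k e_k ⊗ e_k` satisfies `tr(E_disc Λ) = 0`, so it yields comparison success
probability `2/3`, strictly less than the optimal value `3/4`. -/
theorem discrimination_strategy_suboptimal_three_states :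
    ((∑ k : Fin 3, (discPOVM k) ⊗ₖ (discPOVM k)) * comparisonOp 3).trace = 0 ∧
    ((2 / 3 : ℂ) +
      ((∑ k : Fin 3, (discPOVM k) ⊗ₖ (discPOVM k)) * comparisonOp 3).trace).re = 2 / 3 ∧
    (2 / 3 : ℝ) < 3 / 4 := by
  have h0 : ((∑ k : Fin 3, (discPOVM k) ⊗ₖ (discPOVM k)) * comparisonOp 3).trace = 0 := by
    simp only [discPOVM, comparisonOp, smul_kronecker, kronecker_smul, Fin.sum_univ_three,
      Fin.isValue, Fin.reduceEq, if_true, if_false, add_mul, mul_add, mul_sub, smul_mul_assoc,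
      mul_smul_comm, zero_add, add_zero, smul_add, trace_add, trace_sub, trace_smul,
      ← mul_kronecker_mul, trace_kronecker, trace_phaseState_three_proj_mul, smul_eq_mul]
    norm_num
  refine ⟨h0, ?_, by norm_num⟩
  rw [h0]
  norm_num
end

section
/- Let φ₀, …, φ_{N−1} be N normalized vectors in ℂ^d. Define r = (1/N)·Σ_{k=0}^{N−1} |φ_k⟩⟨φ_k| and R = (1/N)·Σ_{k=0}^{N−1} |φ_k⊗φ_k⟩⟨φ_k⊗φ_k|, and let λ_max and λ_min denote the maximum and minimum of the nonzero eigenvalues of r. If λ_min ≥ √(2·λ_max/N), then the matrix Λ = (2/N)·R − r⊗r is negative semidefinite. -/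
open Matrix Kronecker ComplexOrder

/-- A diagonal matrix dominates `c` times the projector onto a unit vector `ψ`, as soon as its
entries are nonnegative and at least `c` on the support of `ψ`. -/
theorem posSemidef_diagonal_sub_smul_vecMulVec {n : Type*} [Fintype n] [DecidableEq n]
    {c : ℝ} (hc : 0 ≤ c) {D : n → ℝ} (hD : ∀ i, 0 ≤ D i) {ψ : n → ℂ}
    (hψ : star ψ ⬝ᵥ ψ = 1) (hsupp : ∀ i, ψ i ≠ 0 → c ≤ D i) :
    (diagonal (fun i => (D i : ℂ)) - (c : ℂ) • vecMulVec ψ (star ψ)).PosSemidef := by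
  classical
  set e : n → ℂ := fun i => if ψ i = 0 then 0 else 1 with he
  set Q : Matrix n n ℂ := diagonal e - vecMulVec ψ (star ψ) with hQ
  have he_star : star e = e := by
    ext i
    by_cases h : ψ i = 0 <;> simp [he, h]
  have hQH : Qᴴ = Q := by
    rw [hQ, conjTranspose_sub, diagonal_conjTranspose, conjTranspose_vecMulVec, star_star, he_star]
  have hee : diagonal e * diagonal e = diagonal e := by
    rw [diagonal_mul_diagonal]
    congr 1
    ext i
    by_cases h : ψ i = 0 <;> simp [he, h]
  have heψ : diagonal e * vecMulVec ψ (star ψ) = vecMulVec ψ (star ψ) := by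
    ext i j
    by_cases h : ψ i = 0 <;> simp [he, h, vecMulVec_apply]
  have hψe : vecMulVec ψ (star ψ) * diagonal e = vecMulVec ψ (star ψ) := by
    ext i j
    by_cases h : ψ j = 0 <;> simp [he, h, vecMulVec_apply]
  have hψψ : vecMulVec ψ (star ψ) * vecMulVec ψ (star ψ) = vecMulVec ψ (star ψ) := by
    rw [vecMulVec_mul_vecMulVec, hψ, one_smul]
  have hQQ : Q * Qᴴ = Q := by
    rw [hQH, hQ, sub_mul, mul_sub, mul_sub, hee, heψ, hψe, hψψ, sub_self, sub_zero]
  have hQpos : Q.PosSemidef := hQQ ▸ posSemidef_self_mul_conjTranspose Q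
  have hdiag : (diagonal (fun i => (D i : ℂ) - c * e i)).PosSemidef := by
    refine PosSemidef.diagonal fun i => ?_
    by_cases h : ψ i = 0
    · simpa [he, h] using hD i
    · simpa [he, h] using hsupp i h
  have hsum : diagonal (fun i => (D i : ℂ)) - (c : ℂ) • vecMulVec ψ (star ψ)
      = diagonal (fun i => (D i : ℂ) - c * e i) + (c : ℂ) • Q := by
    ext i j
    by_cases h : i = j
    · subst h
      simp [hQ]
      ring
    · simp [hQ, h]
  rw [hsum]
  exact hdiag.add (hQpos.smul (by exact_mod_cast hc))

/-- If every nonzero eigenvalue of an average of rank-one projectors is at least `c`, then the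
average dominates `c` times each of the projectors. -/
theorem posSemidef_average_sub_smul_vecMulVec {ι n : Type*} [Fintype ι] [Fintype n]
    [DecidableEq n] {φ : ι → n → ℂ} (hφ : ∀ k, star (φ k) ⬝ᵥ φ k = 1) {a : ℝ} (ha : 0 < a)
    {r : Matrix n n ℂ} (hr : r = (a : ℂ) • ∑ k, vecMulVec (φ k) (star (φ k)))
    (hrH : r.IsHermitian) {c : ℝ} (hc : 0 ≤ c)
    (hev : ∀ i, hrH.eigenvalues i ≠ 0 → c ≤ hrH.eigenvalues i) (k : ι) :
    (r - (c : ℂ) • vecMulVec (φ k) (star (φ k))).PosSemidef := by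
  set U : Matrix n n ℂ := (hrH.eigenvectorUnitary : Matrix n n ℂ)
  have hUU : U * Uᴴ = 1 := Unitary.mul_star_self_of_mem hrH.eigenvectorUnitary.2
  have hUU' : Uᴴ * U = 1 := Unitary.star_mul_self_of_mem hrH.eigenvectorUnitary.2
  set ψ : ι → n → ℂ := fun l => Uᴴ *ᵥ φ l with hψ
  have hconj (l : ι) : Uᴴ * vecMulVec (φ l) (star (φ l)) * U = vecMulVec (ψ l) (star (ψ l)) := by
    rw [mul_vecMulVec, vecMulVec_mul, hψ, star_mulVec, conjTranspose_conjTranspose]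
  have hspec : Uᴴ * r * U = diagonal (fun i => (hrH.eigenvalues i : ℂ)) := by
    have h : r = U * diagonal (fun i => (hrH.eigenvalues i : ℂ)) * Uᴴ := hrH.spectral_theorem
    calc Uᴴ * r * U
        = (Uᴴ * U) * diagonal (fun i => (hrH.eigenvalues i : ℂ)) * (Uᴴ * U) := by
          conv_lhs => rw [h]
          simp only [Matrix.mul_assoc]
      _ = _ := by rw [hUU', Matrix.one_mul, Matrix.mul_one]
  have hav : diagonal (fun i => (hrH.eigenvalues i : ℂ))
      = (a : ℂ) • ∑ l, vecMulVec (ψ l) (star (ψ l)) := by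
    rw [← hspec]
    conv_lhs => rw [hr]
    simp only [Matrix.mul_smul, Matrix.smul_mul, Matrix.mul_sum, Matrix.sum_mul, hconj]
  have hval (i : n) : hrH.eigenvalues i = a * ∑ l, ‖ψ l i‖ ^ 2 := by
    have h := congrFun (congrFun hav i) i
    simp only [diagonal_apply_eq, Matrix.smul_apply, Matrix.sum_apply, vecMulVec_apply, Pi.star_apply,
      smul_eq_mul, RCLike.star_def, Complex.mul_conj'] at h
    exact_mod_cast h
  have hnonneg (i : n) : 0 ≤ hrH.eigenvalues i := by
    rw [hval]
    positivity
  have hsupp (i : n) (hi : ψ k i ≠ 0) : c ≤ hrH.eigenvalues i := by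
    refine hev i (ne_of_gt ?_)
    rw [hval]
    refine mul_pos ha (Finset.sum_pos' (fun _ _ => by positivity) ⟨k, Finset.mem_univ k, ?_⟩)
    positivity
  have hψ_norm : star (ψ k) ⬝ᵥ ψ k = 1 := by
    rw [hψ, star_mulVec, conjTranspose_conjTranspose, dotProduct_mulVec, vecMul_vecMul, hUU,
      vecMul_one, hφ]
  have hpos := (posSemidef_diagonal_sub_smul_vecMulVec hc hnonneg hψ_norm
    hsupp).mul_mul_conjTranspose_same U
  have hback : U * (diagonal (fun i => (hrH.eigenvalues i : ℂ))
      - (c : ℂ) • vecMulVec (ψ k) (star (ψ k))) * Uᴴ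
      = r - (c : ℂ) • vecMulVec (φ k) (star (φ k)) := by
    rw [← hspec, ← hconj, ← Matrix.smul_mul, ← Matrix.mul_smul, ← Matrix.sub_mul,
      ← Matrix.mul_sub]
    calc _ = (U * Uᴴ) * (r - (c : ℂ) • vecMulVec (φ k) (star (φ k))) * (U * Uᴴ) := by
          simp only [Matrix.mul_assoc]
      _ = _ := by rw [hUU, Matrix.one_mul, Matrix.mul_one]
  rwa [hback] at hpos

/-- Sufficient condition for the no-measurement strategy to be optimal: if the minimum
nonzero eigenvalue `λ_min` of the average state `r = (1/N) Σ_k |φ_k⟩⟨φ_k|` satisfies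
`λ_min ≥ √(2 λ_max / N)`, then `Λ = (2/N) R - r ⊗ r` is negative semidefinite, where
`R = (1/N) Σ_k |φ_k⊗φ_k⟩⟨φ_k⊗φ_k|`. -/
theorem no_measurement_sufficient_condition
    {d N : ℕ} (hN : 0 < N) (φ : Fin N → Fin d → ℂ)
    (hφ : ∀ k, star (φ k) ⬝ᵥ φ k = 1)
    (r : Matrix (Fin d) (Fin d) ℂ)
    (hr : r = (1 / (N : ℂ)) • ∑ k, Matrix.vecMulVec (φ k) (star (φ k)))
    (R : Matrix (Fin d × Fin d) (Fin d × Fin d) ℂ)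
    (hR : R = (1 / (N : ℂ)) • ∑ k,
      Matrix.vecMulVec (fun p : Fin d × Fin d => φ k p.1 * φ k p.2)
        (star (fun p : Fin d × Fin d => φ k p.1 * φ k p.2)))
    (hrH : r.IsHermitian) (lmax lmin : ℝ)
    (hlmax : IsGreatest {x : ℝ | ∃ i, hrH.eigenvalues i = x ∧ x ≠ 0} lmax)
    (hlmin : IsLeast {x : ℝ | ∃ i, hrH.eigenvalues i = x ∧ x ≠ 0} lmin)
    (hcond : lmin ≥ Real.sqrt (2 * lmax / N)) :
    (-((2 / (N : ℂ)) • R - r ⊗ₖ r)).PosSemidef := by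
  have hN' : (0 : ℝ) < N := by exact_mod_cast hN
  have hr' : r = ((1 / N : ℝ) : ℂ) • ∑ k, vecMulVec (φ k) (star (φ k)) := by
    rw [hr]
    push_cast
    rfl
  have hle : lmin ≤ lmax := hlmax.2 hlmin.1
  have hlmin_nonneg : 0 ≤ lmin := (Real.sqrt_nonneg _).trans hcond
  have hlmin_pos : 0 < lmin := by
    obtain ⟨_, _, hne⟩ := hlmin.1
    exact lt_of_le_of_ne hlmin_nonneg hne.symm
  have hc : 2 / (N : ℝ) ≤ lmin := by
    have hsq : 2 * lmax / N ≤ lmin ^ 2 := (Real.sqrt_le_left hlmin_nonneg).1 hcond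
    have hmono : 2 * lmin / N ≤ 2 * lmax / N := by gcongr
    refine le_of_mul_le_mul_right ?_ hlmin_pos
    calc 2 / (N : ℝ) * lmin = 2 * lmin / N := by ring
      _ ≤ lmin * lmin := by nlinarith
  have hdom (k : Fin N) := posSemidef_average_sub_smul_vecMulVec hφ (by positivity) hr' hrH
    (c := 2 / N) (by positivity) (fun i hi => hc.trans (hlmin.2 ⟨i, rfl, hi⟩)) k
  have hdecomp : -((2 / (N : ℂ)) • R - r ⊗ₖ r) = (1 / (N : ℂ)) • ∑ k,
      vecMulVec (φ k) (star (φ k)) ⊗ₖ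
        (r - ((2 / N : ℝ) : ℂ) • vecMulVec (φ k) (star (φ k))) := by
    ext ⟨i, i'⟩ ⟨j, j'⟩
    have hij : r i j = 1 / (N : ℂ) * ∑ k, φ k i * star (φ k j) := by
      rw [hr]
      simp [Matrix.sum_apply, vecMulVec_apply]
    simp only [hR, Matrix.neg_apply, Matrix.sub_apply, Matrix.smul_apply, Matrix.sum_apply, kroneckerMap_apply,
      vecMulVec_apply, Pi.star_apply, smul_eq_mul, star_mul', mul_sub, Finset.sum_sub_distrib,
      ← Finset.sum_mul]
    rw [hij, neg_sub]
    push_cast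
    simp only [Finset.mul_sum, Finset.sum_mul]
    congr 1 <;> exact Finset.sum_congr rfl fun k _ => by ring
  rw [hdecomp]
  refine PosSemidef.smul (posSemidef_sum _ fun k _ => ?_) ?_
  · exact (posSemidef_vecMulVec_self_star (φ k)).kronecker (hdom k)
  · simp
end

section
/- Let {φ₀^A, …, φ_{N−1}^A} be N normalized vectors in ℂ^{d_A} and {ψ₀^B, …, ψ_{N−1}^B} be N normalized vectors in ℂ^{d_B}. Define r_φ = (1/N)·Σ_k |φ_k^A⟩⟨φ_k^A|, r_ψ = (1/N)·Σ_k |ψ_k^B⟩⟨ψ_k^B|, and R = (1/N)·Σ_k |φ_k^A⊗ψ_k^B⟩⟨φ_k^A⊗ψ_k^B|. Then the maximum eigenvalue of R is at most the minimum of the maximum eigenvalue of r_φ and the maximum eigenvalue of r_ψ: λ_max(R) ≤ min{ λ_max(r_φ), λ_max(r_ψ) }. -/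
open Matrix

open scoped MatrixOrder ComplexOrder Kronecker

section

variable {m n ι : Type*}

theorem vecMulVec_mul_self_star (u : m → ℂ) (v : n → ℂ) :
    vecMulVec (fun p : m × n => u p.1 * v p.2) (star fun p : m × n => u p.1 * v p.2)
      = vecMulVec u (star u) ⊗ₖ vecMulVec v (star v) := by
  ext p q
  simp [vecMulVec_apply, mul_mul_mul_comm]

variable [Fintype m] [Fintype n]

theorem Matrix.kronecker_le_kronecker_right {A : Matrix m m ℂ} (hA : 0 ≤ A)
    {B C : Matrix n n ℂ} (h : B ≤ C) : A ⊗ₖ B ≤ A ⊗ₖ C := by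
  have hsub : A ⊗ₖ C - A ⊗ₖ B = A ⊗ₖ (C - B) := by
    rw [sub_eq_iff_eq_add, ← kronecker_add, sub_add_cancel]
  rw [Matrix.le_iff, hsub]
  exact (nonneg_iff_posSemidef.mp hA).kronecker h

theorem Matrix.kronecker_le_kronecker_left {B C : Matrix m m ℂ} (h : B ≤ C)
    {A : Matrix n n ℂ} (hA : 0 ≤ A) : B ⊗ₖ A ≤ C ⊗ₖ A := by
  have hsub : C ⊗ₖ A - B ⊗ₖ A = (C - B) ⊗ₖ A := by
    rw [sub_eq_iff_eq_add, ← add_kronecker, sub_add_cancel]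
  rw [Matrix.le_iff, hsub]
  exact PosSemidef.kronecker h (nonneg_iff_posSemidef.mp hA)

variable [Fintype ι]

theorem Matrix.IsHermitian.forall_eigenvalues_le_iff [DecidableEq n] {A : Matrix n n ℂ}
    (hA : A.IsHermitian) {l : ℝ} : (∀ i, hA.eigenvalues i ≤ l) ↔ A ≤ algebraMap ℝ (Matrix n n ℂ) l := by
  rw [le_algebraMap_iff_spectrum_le (ha := hA), hA.spectrum_real_eq_range_eigenvalues,
    Set.forall_mem_range]

theorem vecMulVec_self_star_le_one [DecidableEq n] {v : n → ℂ} (hv : star v ⬝ᵥ v = 1) :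
    vecMulVec v (star v) ≤ 1 := by
  have hH : (1 - vecMulVec v (star v))ᴴ = 1 - vecMulVec v (star v) := by
    simp [conjTranspose_vecMulVec]
  have hP : (1 - vecMulVec v (star v))ᴴ * (1 - vecMulVec v (star v))
      = 1 - vecMulVec v (star v) := by
    rw [hH]
    simp [sub_mul, mul_sub, vecMulVec_mul_vecMulVec, hv]
  rw [Matrix.le_iff, ← hP]
  exact posSemidef_conjTranspose_mul_self _

theorem smul_sum_vecMulVec_mul_le_kronecker_one [DecidableEq n] {c : ℂ} (hc : 0 ≤ c)
    (u : ι → m → ℂ) {v : ι → n → ℂ} (hv : ∀ k, star (v k) ⬝ᵥ v k = 1) :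
    c • ∑ k, vecMulVec (fun p : m × n => u k p.1 * v k p.2)
        (star fun p : m × n => u k p.1 * v k p.2)
      ≤ (c • ∑ k, vecMulVec (u k) (star (u k))) ⊗ₖ (1 : Matrix n n ℂ) := by
  have hsum : (∑ k, vecMulVec (u k) (star (u k))) ⊗ₖ (1 : Matrix n n ℂ)
      = ∑ k, vecMulVec (u k) (star (u k)) ⊗ₖ (1 : Matrix n n ℂ) :=
    map_sum ((kroneckerBilinear (R := ℂ) (α := ℂ)).flip (1 : Matrix n n ℂ)) _ _
  simp_rw [vecMulVec_mul_self_star]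
  rw [smul_kronecker, hsum, Matrix.le_iff, ← smul_sub, ← Finset.sum_sub_distrib]
  exact (posSemidef_sum _ fun k _ => kronecker_le_kronecker_right
    (posSemidef_vecMulVec_self_star _).nonneg (vecMulVec_self_star_le_one (hv k))).smul hc

theorem smul_sum_vecMulVec_mul_le_one_kronecker [DecidableEq m] {c : ℂ} (hc : 0 ≤ c)
    {u : ι → m → ℂ} (hu : ∀ k, star (u k) ⬝ᵥ u k = 1) (v : ι → n → ℂ) :
    c • ∑ k, vecMulVec (fun p : m × n => u k p.1 * v k p.2)
        (star fun p : m × n => u k p.1 * v k p.2)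
      ≤ (1 : Matrix m m ℂ) ⊗ₖ (c • ∑ k, vecMulVec (v k) (star (v k))) := by
  have hsum : (1 : Matrix m m ℂ) ⊗ₖ (∑ k, vecMulVec (v k) (star (v k)))
      = ∑ k, (1 : Matrix m m ℂ) ⊗ₖ vecMulVec (v k) (star (v k)) :=
    map_sum (kroneckerBilinear (R := ℂ) (α := ℂ) (1 : Matrix m m ℂ)) _ _
  simp_rw [vecMulVec_mul_self_star]
  rw [kronecker_smul, hsum, Matrix.le_iff, ← smul_sub, ← Finset.sum_sub_distrib]
  exact (posSemidef_sum _ fun k _ => kronecker_le_kronecker_left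
    (vecMulVec_self_star_le_one (hu k)) (posSemidef_vecMulVec_self_star _).nonneg).smul hc

theorem algebraMap_kronecker_one [DecidableEq m] [DecidableEq n] (l : ℝ) :
    algebraMap ℝ (Matrix m m ℂ) l ⊗ₖ (1 : Matrix n n ℂ)
      = algebraMap ℝ (Matrix (m × n) (m × n) ℂ) l := by
  rw [Algebra.algebraMap_eq_smul_one, smul_kronecker, one_kronecker_one,
    Algebra.algebraMap_eq_smul_one]

theorem one_kronecker_algebraMap [DecidableEq m] [DecidableEq n] (l : ℝ) :
    (1 : Matrix m m ℂ) ⊗ₖ algebraMap ℝ (Matrix n n ℂ) l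
      = algebraMap ℝ (Matrix (m × n) (m × n) ℂ) l := by
  rw [Algebra.algebraMap_eq_smul_one, kronecker_smul, one_kronecker_one,
    Algebra.algebraMap_eq_smul_one]

end

/-- Appendix theorem: the maximum eigenvalue of
`R = (1/N) Σ_k |φ_k⊗ψ_k⟩⟨φ_k⊗ψ_k|` is at most the minimum of the maximum eigenvalues
of `r_φ = (1/N) Σ_k |φ_k⟩⟨φ_k|` and `r_ψ = (1/N) Σ_k |ψ_k⟩⟨ψ_k|`. -/
theorem max_eigenvalue_correlated_le_min
    {dA dB N : ℕ} (hN : 0 < N)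
    (φ : Fin N → Fin dA → ℂ) (ψ : Fin N → Fin dB → ℂ)
    (hφ : ∀ k, star (φ k) ⬝ᵥ φ k = 1) (hψ : ∀ k, star (ψ k) ⬝ᵥ ψ k = 1)
    (rφ : Matrix (Fin dA) (Fin dA) ℂ)
    (hrφ : rφ = (1 / (N : ℂ)) • ∑ k, Matrix.vecMulVec (φ k) (star (φ k)))
    (rψ : Matrix (Fin dB) (Fin dB) ℂ)
    (hrψ : rψ = (1 / (N : ℂ)) • ∑ k, Matrix.vecMulVec (ψ k) (star (ψ k)))
    (R : Matrix (Fin dA × Fin dB) (Fin dA × Fin dB) ℂ)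
    (hR : R = (1 / (N : ℂ)) • ∑ k,
      Matrix.vecMulVec (fun p : Fin dA × Fin dB => φ k p.1 * ψ k p.2)
        (star (fun p : Fin dA × Fin dB => φ k p.1 * ψ k p.2)))
    (hrφH : rφ.IsHermitian) (hrψH : rψ.IsHermitian) (hRH : R.IsHermitian)
    (lR lφ lψ : ℝ)
    (hlR : IsGreatest (Set.range hRH.eigenvalues) lR)
    (hlφ : IsGreatest (Set.range hrφH.eigenvalues) lφ)
    (hlψ : IsGreatest (Set.range hrψH.eigenvalues) lψ) :
    lR ≤ min lφ lψ := by
  have hc : (0 : ℂ) ≤ 1 / (N : ℂ) := by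
    have h : (1 / (N : ℂ)) = ((1 / (N : ℝ) : ℝ) : ℂ) := by push_cast; rfl
    exact h ▸ Complex.zero_le_real.mpr (by positivity)
  obtain ⟨i, rfl⟩ := hlR.1
  have hA := hrφH.forall_eigenvalues_le_iff.mp fun j => hlφ.2 ⟨j, rfl⟩
  have hB := hrψH.forall_eigenvalues_le_iff.mp fun j => hlψ.2 ⟨j, rfl⟩
  refine le_min (hRH.forall_eigenvalues_le_iff.mpr ?_ i)
    (hRH.forall_eigenvalues_le_iff.mpr ?_ i)
  · rw [← algebraMap_kronecker_one, hR]
    refine (smul_sum_vecMulVec_mul_le_kronecker_one hc φ hψ).trans ?_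
    rw [← hrφ]
    exact kronecker_le_kronecker_left hA PosSemidef.one.nonneg
  · rw [← one_kronecker_algebraMap, hR]
    refine (smul_sum_vecMulVec_mul_le_one_kronecker hc hφ ψ).trans ?_
    rw [← hrψ]
    exact kronecker_le_kronecker_right PosSemidef.one.nonneg hB
end

section
/- Let φ₁, φ₂ be unit vectors in ℂ² with s := ⟨φ₁, φ₂⟩ real, s² ≠ 1. Define X₁ = φ₁⊗φ₁ + φ₂⊗φ₂ and X₂ = φ₁⊗φ₂ + φ₂⊗φ₁ in ℂ²⊗ℂ². Then ‖X₁‖² = ‖X₂‖² = 2(1 + s²), and the inner product of the normalized vectors X̃₁ = X₁/‖X₁‖ and X̃₂ = X₂/‖X₂‖ equals ⟨X̃₁, X̃₂⟩ = 2s/(1 + s²). -/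
open Matrix

/-- The standard Hermitian form is multiplicative on product vectors. -/
theorem star_tensor_dotProduct_tensor {m n : Type*} [Fintype m] [Fintype n]
    (a c : m → ℂ) (b d : n → ℂ) :
    star (fun p : m × n => a p.1 * b p.2) ⬝ᵥ (fun p : m × n => c p.1 * d p.2)
      = (star a ⬝ᵥ c) * (star b ⬝ᵥ d) := by
  simp only [dotProduct, Fintype.sum_prod_type, Finset.sum_mul_sum, Pi.star_apply, star_mul']
  exact Finset.sum_congr rfl fun i _ => Finset.sum_congr rfl fun j _ => by ring

/-- The Hermitian form of two sums of product vectors, expanded into forms of the factors. -/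
theorem star_add_tensor_dotProduct_add_tensor {m n : Type*} [Fintype m] [Fintype n]
    (a a' c c' : m → ℂ) (b b' d d' : n → ℂ) :
    star (fun p : m × n => a p.1 * b p.2 + a' p.1 * b' p.2) ⬝ᵥ
        (fun p : m × n => c p.1 * d p.2 + c' p.1 * d' p.2)
      = (star a ⬝ᵥ c) * (star b ⬝ᵥ d) + (star a ⬝ᵥ c') * (star b ⬝ᵥ d')
        + (star a' ⬝ᵥ c) * (star b' ⬝ᵥ d) + (star a' ⬝ᵥ c') * (star b' ⬝ᵥ d') := by
  rw [← star_tensor_dotProduct_tensor a c b d, ← star_tensor_dotProduct_tensor a c' b d',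
    ← star_tensor_dotProduct_tensor a' c b' d, ← star_tensor_dotProduct_tensor a' c' b' d']
  simp only [dotProduct, ← Finset.sum_add_distrib]
  refine Finset.sum_congr rfl fun _ _ => ?_
  simp only [Pi.star_apply, star_add]
  ring

/-- For unit vectors `φ₁, φ₂ ∈ ℂ²` with real overlap `s = ⟨φ₁,φ₂⟩`, `s² ≠ 1`, the
symmetric vectors `X₁ = φ₁⊗φ₁ + φ₂⊗φ₂` and `X₂ = φ₁⊗φ₂ + φ₂⊗φ₁` have squared norm
`2(1+s²)`, and their normalizations have inner product `2s/(1+s²)`. -/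
theorem symmetric_subspace_vectors_overlap
    (φ₁ φ₂ : Fin 2 → ℂ) (s : ℝ)
    (h₁ : star φ₁ ⬝ᵥ φ₁ = 1) (h₂ : star φ₂ ⬝ᵥ φ₂ = 1)
    (hs : star φ₁ ⬝ᵥ φ₂ = (s : ℂ)) (hs1 : s^2 ≠ 1)
    (X₁ X₂ : Fin 2 × Fin 2 → ℂ)
    (hX₁ : X₁ = fun p => φ₁ p.1 * φ₁ p.2 + φ₂ p.1 * φ₂ p.2)
    (hX₂ : X₂ = fun p => φ₁ p.1 * φ₂ p.2 + φ₂ p.1 * φ₁ p.2) :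
    star X₁ ⬝ᵥ X₁ = ((2 * (1 + s^2) : ℝ) : ℂ) ∧
    star X₂ ⬝ᵥ X₂ = ((2 * (1 + s^2) : ℝ) : ℂ) ∧
    star ((Real.sqrt ((star X₁ ⬝ᵥ X₁).re))⁻¹ • X₁) ⬝ᵥ
        ((Real.sqrt ((star X₂ ⬝ᵥ X₂).re))⁻¹ • X₂)
      = ((2 * s / (1 + s^2) : ℝ) : ℂ) := by
  have hs' : star φ₂ ⬝ᵥ φ₁ = (s : ℂ) := by
    rw [star_dotProduct, hs]
    simp
  have hX₁₁ : star X₁ ⬝ᵥ X₁ = ((2 * (1 + s^2) : ℝ) : ℂ) := by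
    rw [hX₁, star_add_tensor_dotProduct_add_tensor, h₁, h₂, hs, hs']
    push_cast
    ring
  have hX₂₂ : star X₂ ⬝ᵥ X₂ = ((2 * (1 + s^2) : ℝ) : ℂ) := by
    rw [hX₂, star_add_tensor_dotProduct_add_tensor, h₁, h₂, hs, hs']
    push_cast
    ring
  have hX₁₂ : star X₁ ⬝ᵥ X₂ = ((4 * s : ℝ) : ℂ) := by
    rw [hX₁, hX₂, star_add_tensor_dotProduct_add_tensor, h₁, h₂, hs, hs']
    push_cast
    ring
  refine ⟨hX₁₁, hX₂₂, ?_⟩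
  rw [hX₁₁, hX₂₂, Complex.ofReal_re, star_smul, star_trivial, smul_dotProduct, dotProduct_smul,
    smul_smul, hX₁₂, ← mul_inv, Real.mul_self_sqrt (by positivity), Complex.real_smul,
    ← Complex.ofReal_mul]
  congr 1
  have : 1 + s^2 ≠ 0 := by positivity
  field_simp
  ring
end

section
/- Let s ∈ (0,1) and μ ≥ 0 be real numbers, and set m = 2μ·(√μ + √(1−s))². If m < s²/2, then (√μ + √(1−s))⁴ + μ² < 1/2 + (1/2)·(√(2m) + 1)·(√(2m) + 1 − 2s). In other words, for every error margin strictly below the critical margin m_c = s²/2, the comparison success probability of the discrimination strategy, P_disc = (√μ + √(1−s))⁴ + μ² with μ determined by the error-margin constraint 2μ(√μ + √(1−s))² = m, is strictly smaller than the optimal comparison success probability P_opt = 1/2 + (1/2)(√(2m)+1)(√(2m)+1−2s). -/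
/-- Below the critical error margin `m_c = s²/2`, the discrimination strategy's
comparison success probability `(√μ + √(1-s))⁴ + μ²` (with `μ` fixed by the margin
constraint `2μ(√μ + √(1-s))² = m`) is strictly smaller than the optimal comparison
success probability `1/2 + (1/2)(√(2m)+1)(√(2m)+1-2s)`. -/
theorem discrimination_strategy_strictly_suboptimal_below_critical_margin
    (s μ m : ℝ) (hs0 : 0 < s) (hs1 : s < 1) (hμ : 0 ≤ μ)
    (hm : m = 2 * μ * (Real.sqrt μ + Real.sqrt (1 - s))^2)
    (hmc : m < s^2 / 2) :
    (Real.sqrt μ + Real.sqrt (1 - s))^4 + μ^2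
      < 1 / 2 + 1 / 2 * (Real.sqrt (2 * m) + 1) * (Real.sqrt (2 * m) + 1 - 2 * s) := by
  obtain ⟨a, ha⟩ : ∃ a, a = Real.sqrt μ := ⟨_, rfl⟩
  obtain ⟨c, hc⟩ : ∃ c, c = Real.sqrt (1 - s) := ⟨_, rfl⟩
  have ha0 : 0 ≤ a := ha ▸ Real.sqrt_nonneg μ
  have hc0 : 0 < c := hc ▸ Real.sqrt_pos.2 (by linarith)
  have hμa : μ = a ^ 2 := by rw [ha, Real.sq_sqrt hμ]
  have hsc : s = 1 - c ^ 2 := by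
    rw [hc, Real.sq_sqrt (by linarith)]
    ring
  rw [← ha, ← hc] at hm ⊢
  have ht0 : 0 ≤ 2 * a * (a + c) := by positivity
  have hmt : 2 * m = (2 * a * (a + c)) ^ 2 := by
    rw [hm, hμa]
    ring
  have hts : 2 * a * (a + c) < s := lt_of_pow_lt_pow_left₀ 2 hs0.le (by linarith)
  rw [hmt, Real.sqrt_sq ht0, hμa]
  have key : 0 < c ^ 2 * (s - 2 * a * (a + c)) := mul_pos (by positivity) (by linarith)
  rw [hsc] at key ⊢
  linarith
end
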